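/- Satisfiability criterion: let (I, δ) be a timely specification. Then δ is satisfiable if and only if for each i ∈ I the function j ↦ δ̂(i,j) is bounded from below on I (by some real number). -/

import Mathlib

noncomputable section

/-- `D ≤ ℝ` (an additive subgroup) is closed under infima of nonempty
bounded-below subsets. -/
def ClosedUnderInf (D : AddSubgroup ℝ) : Prop :=
  ∀ S : Set ℝ, S.Nonempty → BddBelow S → S ⊆ (D : Set ℝ) → sInf S ∈ D

/-- A timely constraint on `I`: on every pair of distinct actions, `δ` takes a value
in `Δ = D ∪ {-∞, +∞}`, viewed inside the extended reals. -/
def IsTimelyConstraint (D : AddSubgroup ℝ) {I : Type*} (δ : I → I → EReal) : Prop :=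
  ∀ i j : I, i ≠ j → δ i j = ⊤ ∨ δ i j = ⊥ ∨ ∃ d : ℝ, d ∈ D ∧ δ i j = (d : EReal)

/-- `t : I → ℝ` takes values in `𝕋` (the nonnegative part of `D`) and satisfies the
timely constraint `δ`, i.e. `t j ≤ t i + δ i j` for all distinct `i, j`. -/
def Satisfies (D : AddSubgroup ℝ) {I : Type*} (δ : I → I → EReal) (t : I → ℝ) : Prop :=
  (∀ i, t i ∈ D) ∧ (∀ i, 0 ≤ t i) ∧
    ∀ i j : I, i ≠ j → (t j : EReal) ≤ (t i : EReal) + δ i j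

/-- A path in the graph `G_δ`: a nonempty finite sequence of vertices, each consecutive
pair being an edge, i.e. a pair of distinct vertices with `δ < ∞`. -/
def IsPath {I : Type*} (δ : I → I → EReal) (p : List I) : Prop :=
  p ≠ [] ∧ p.Chain' fun a b => a ≠ b ∧ δ a b < ⊤

/-- The length of a path: the sum of the weights of its edges. -/
def pathLength {I : Type*} (δ : I → I → EReal) (p : List I) : EReal :=
  ((p.zip p.tail).map fun q => δ q.1 q.2).sum

/-- The canonical form `δ̂` of `δ`: the distance function of `G_δ`, i.e. the infimum in
the extended reals of the lengths of all paths from `i` to `j` (`+∞` if there is none). -/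
def canon {I : Type*} (δ : I → I → EReal) (i j : I) : EReal :=
  sInf {L : EReal | ∃ p : List I,
    IsPath δ p ∧ p.head? = some i ∧ p.getLast? = some j ∧ pathLength δ p = L}

/-- A negative cycle in `G_δ`: a path with at least two entries, whose first and last
vertices coincide, of negative length. -/
def IsNegativeCycle {I : Type*} (δ : I → I → EReal) (p : List I) : Prop :=
  IsPath δ p ∧ 2 ≤ p.length ∧ p.head? = p.getLast? ∧ pathLength δ p < 0

lemma pathLength_cons_cons {I : Type*} (δ : I → I → EReal) (a b : I) (l : List I) :
    pathLength δ (a :: b :: l) = δ a b + pathLength δ (b :: l) := by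
  simp [pathLength]

lemma isPath_cons_cons {I : Type*} {δ : I → I → EReal} {a b : I} {l : List I} :
    IsPath δ (a :: b :: l) ↔ (a ≠ b ∧ δ a b < ⊤) ∧ IsPath δ (b :: l) := by
  simp [IsPath, List.Chain']

lemma pathLength_eq_bot_or_mem {D : AddSubgroup ℝ} {I : Type*} {δ : I → I → EReal}
    (hδ : IsTimelyConstraint D δ) (l : List I) (i : I) (h : IsPath δ (i :: l)) :
    pathLength δ (i :: l) = ⊥ ∨ ∃ d : ℝ, d ∈ D ∧ pathLength δ (i :: l) = (d : EReal) := by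
  induction l generalizing i with
  | nil => exact Or.inr ⟨0, D.zero_mem, by simp [pathLength]⟩
  | cons j l ih =>
    rw [isPath_cons_cons] at h
    rw [pathLength_cons_cons]
    rcases hδ i j h.1.1 with h1 | h1 | ⟨d, hd, h1⟩
    · exact absurd h1 h.1.2.ne
    · simp [h1]
    · rcases ih j h.2 with h2 | ⟨e, he, h2⟩
      · simp [h2]
      · exact Or.inr ⟨d + e, D.add_mem hd he, by rw [h1, h2, EReal.coe_add]⟩

lemma Satisfies.le_add_pathLength {D : AddSubgroup ℝ} {I : Type*} {δ : I → I → EReal}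
    {t : I → ℝ} (ht : Satisfies D δ t) (l : List I) (i j : I) (h : IsPath δ (i :: l))
    (hj : (i :: l).getLast? = some j) :
    (t j : EReal) ≤ (t i : EReal) + pathLength δ (i :: l) := by
  induction l generalizing i with
  | nil =>
    obtain rfl : i = j := by simpa using hj
    simp [pathLength]
  | cons k l ih =>
    rw [isPath_cons_cons] at h
    rw [pathLength_cons_cons, ← add_assoc]
    have hk := ih k h.2 (by simpa using hj)
    exact hk.trans (by gcongr; exact ht.2.2 i k h.1.1)

lemma canon_le_pathLength {I : Type*} {δ : I → I → EReal} (i : I) (l : List I)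
    (h : IsPath δ (i :: l)) : ∃ j, canon δ i j ≤ pathLength δ (i :: l) :=
  ⟨(i :: l).getLast (by simp), sInf_le ⟨i :: l, h, rfl, List.getLast?_eq_getLast_of_ne_nil _, rfl⟩⟩

lemma isPath_singleton {I : Type*} (δ : I → I → EReal) (i : I) : IsPath δ [i] := by
  simp [IsPath, List.Chain']

/-- The set of real path lengths of paths starting at a given vertex. -/
def realPathLengths {I : Type*} (δ : I → I → EReal) (i : I) : Set ℝ :=
  {x | ∃ l : List I, IsPath δ (i :: l) ∧ pathLength δ (i :: l) = (x : EReal)}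

lemma zero_mem_realPathLengths {I : Type*} (δ : I → I → EReal) (i : I) :
    0 ∈ realPathLengths δ i :=
  ⟨[], isPath_singleton δ i, by simp [pathLength]⟩

lemma realPathLengths_subset {D : AddSubgroup ℝ} {I : Type*} {δ : I → I → EReal}
    (hδ : IsTimelyConstraint D δ) (i : I) : realPathLengths δ i ⊆ (D : Set ℝ) := by
  rintro x ⟨l, hl, hx⟩
  rcases pathLength_eq_bot_or_mem hδ l i hl with h | ⟨d, hd, h⟩
  · exact absurd (hx.symm.trans h) (EReal.coe_ne_bot x)
  · rwa [EReal.coe_injective (hx.symm.trans h)]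

lemma satisfies_neg_sInf_realPathLengths {D : AddSubgroup ℝ} (hD : ClosedUnderInf D)
    {I : Type*} {δ : I → I → EReal} (hδ : IsTimelyConstraint D δ)
    (h : ∀ i : I, ∃ b : ℝ, ∀ j : I, (b : EReal) ≤ canon δ i j) :
    Satisfies D δ fun i => -sInf (realPathLengths δ i) := by
  have hlow (i : I) : ∃ b : ℝ, ∀ l, IsPath δ (i :: l) → (b : EReal) ≤ pathLength δ (i :: l) := by
    obtain ⟨b, hb⟩ := h i
    refine ⟨b, fun l hl => ?_⟩
    obtain ⟨j, hj⟩ := canon_le_pathLength i l hl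
    exact (hb j).trans hj
  have hbdd (i : I) : BddBelow (realPathLengths δ i) := by
    obtain ⟨b, hb⟩ := hlow i
    refine ⟨b, ?_⟩
    rintro x ⟨l, hl, hx⟩
    exact EReal.coe_le_coe_iff.1 (hx ▸ hb l hl)
  have hne (i : I) : (realPathLengths δ i).Nonempty := ⟨0, zero_mem_realPathLengths δ i⟩
  refine ⟨fun i => D.neg_mem (hD _ (hne i) (hbdd i) (realPathLengths_subset hδ i)),
    fun i => neg_nonneg.2 (csInf_le (hbdd i) (zero_mem_realPathLengths δ i)), fun i j hij => ?_⟩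
  rcases hδ i j hij with h1 | h1 | ⟨d, -, h1⟩
  · rw [h1, EReal.coe_add_top]
    exact le_top
  · obtain ⟨b, hb⟩ := hlow i
    have hp : IsPath δ [i, j] :=
      isPath_cons_cons.2 ⟨⟨hij, by simp [h1]⟩, isPath_singleton δ j⟩
    have := hb [j] hp
    simp [pathLength_cons_cons, h1] at this
  · rw [h1, ← EReal.coe_add, EReal.coe_le_coe_iff]
    have : sInf (realPathLengths δ i) - d ≤ sInf (realPathLengths δ j) := by
      refine le_csInf (hne j) ?_
      rintro x ⟨l, hl, hx⟩
      rw [sub_le_iff_le_add']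
      refine csInf_le (hbdd i) ⟨j :: l, isPath_cons_cons.2 ⟨⟨hij, ?_⟩, hl⟩, ?_⟩
      · rw [h1]
        exact EReal.coe_lt_top d
      · rw [pathLength_cons_cons, h1, hx, EReal.coe_add]
    linarith

/-- Satisfiability criterion: `δ` is satisfiable iff for each `i`, the
function `j ↦ δ̂(i,j)` is bounded from below by some real number. -/
theorem satisfiable_iff_canon_bddBelow (D : AddSubgroup ℝ) (hD : ClosedUnderInf D)
    {I : Type*} (δ : I → I → EReal) (hδ : IsTimelyConstraint D δ) :
    (∃ t : I → ℝ, Satisfies D δ t) ↔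
      ∀ i : I, ∃ b : ℝ, ∀ j : I, (b : EReal) ≤ canon δ i j := by
  refine ⟨?_, fun h => ⟨_, satisfies_neg_sInf_realPathLengths hD hδ h⟩⟩
  rintro ⟨t, ht⟩ i
  refine ⟨-t i, fun j => le_sInf ?_⟩
  rintro _ ⟨_ | ⟨k, l⟩, hp, hi, hj, rfl⟩
  · exact absurd rfl hp.1
  · obtain rfl : k = i := by simpa using hi
    have h0 : ((0 : ℝ) : EReal) ≤ (t k : EReal) + pathLength δ (k :: l) :=
      (EReal.coe_le_coe_iff.2 (ht.2.1 j)).trans (ht.le_add_pathLength l k j hp hj)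
    induction h : pathLength δ (k :: l) with
    | bot => simp [h] at h0
    | top => exact le_top
    | coe x =>
      rw [h, ← EReal.coe_add, EReal.coe_le_coe_iff] at h0
      rw [EReal.coe_le_coe_iff]
      linarith
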